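/- For every y ∈ ℝ^d, the vector λ = (1/(d+1)) 𝟙_{d+1} + (d/(d+1)) X_d y satisfies Σ_{j=1}^{d+1} λ_j² = (1 + d‖y‖₂²)/(d+1); in particular, if ‖y‖₂ ≤ 1 then Σ_{j=1}^{d+1} λ_j² ≤ 1. -/

import Mathlib

open Matrix

/-- The recursively defined matrix `X_d ∈ ℝ^{(d+1)×d}` whose rows are the vertices of a
regular simplex inscribed in the unit sphere of `ℝ^d`:  `X_1 = (-1; 1)`, and for `d > 1`,
the top-left `d × (d-1)` block of `X_d` is `R_d • X_{d-1}` with `R_d = √(d²-1)/d`, the last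
column has its first `d` entries equal to `-1/d` and last entry `1`, and the last row is
`(0, …, 0, 1)`. -/
noncomputable def simplexPts : (d : ℕ) → Matrix (Fin (d + 1)) (Fin d) ℝ
  | 0 => fun _ j => j.elim0
  | 1 => fun i _ => if (i : ℕ) = 0 then -1 else 1
  | (d + 2) => fun i j =>
      if hj : (j : ℕ) < d + 1 then
        if hi : (i : ℕ) < d + 2 then
          (Real.sqrt (((d : ℝ) + 2) ^ 2 - 1) / ((d : ℝ) + 2)) *
            simplexPts (d + 1) ⟨i, hi⟩ ⟨j, hj⟩
        else 0
      else if (i : ℕ) < d + 2 then -1 / ((d : ℝ) + 2) else 1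

/-- The barycentric coordinates of `y ∈ ℝ^d` with respect to the rows of `X_d`:
`λ(y) = (1/(d+1)) 𝟙_{d+1} + (d/(d+1)) X_d y`.  These are also the values at `y` of the
degree-one fundamental Lagrange polynomials for interpolation at the rows of `X_d`. -/
noncomputable def bary (d : ℕ) (y : Fin d → ℝ) : Fin (d + 1) → ℝ :=
  fun i => 1 / ((d : ℝ) + 1) + ((d : ℝ) / ((d : ℝ) + 1)) * (simplexPts d *ᵥ y) i

theorem simplexPts_mulVec_castSucc (d : ℕ) (y : Fin (d + 2) → ℝ) (i : Fin (d + 2)) :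
    (simplexPts (d + 2) *ᵥ y) i.castSucc =
      Real.sqrt (((d : ℝ) + 2) ^ 2 - 1) / ((d : ℝ) + 2) *
        (simplexPts (d + 1) *ᵥ fun k => y k.castSucc) i -
      y (Fin.last (d + 1)) / ((d : ℝ) + 2) := by
  have h (k : Fin (d + 1)) : simplexPts (d + 2) i.castSucc k.castSucc =
      Real.sqrt (((d : ℝ) + 2) ^ 2 - 1) / ((d : ℝ) + 2) * simplexPts (d + 1) i k := by
    simp [simplexPts, -Order.lt_add_one_iff]
  have hl : simplexPts (d + 2) i.castSucc (Fin.last (d + 1)) = -1 / ((d : ℝ) + 2) := by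
    simp [simplexPts]
  simp only [mulVec, dotProduct]
  rw [Fin.sum_univ_castSucc, hl, Finset.mul_sum]
  simp only [h, mul_assoc]
  ring

theorem simplexPts_mulVec_last (d : ℕ) (y : Fin (d + 2) → ℝ) :
    (simplexPts (d + 2) *ᵥ y) (Fin.last (d + 2)) = y (Fin.last (d + 1)) := by
  simp only [mulVec, dotProduct]
  rw [Fin.sum_univ_castSucc]
  simp [simplexPts, -Order.lt_add_one_iff]

theorem sum_simplexPts_mulVec (d : ℕ) (y : Fin (d + 1) → ℝ) :
    ∑ i, (simplexPts (d + 1) *ᵥ y) i = 0 := by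
  induction d with
  | zero => simp [Fin.sum_univ_two, mulVec, dotProduct, simplexPts]
  | succ d ih =>
    rw [Fin.sum_univ_castSucc, simplexPts_mulVec_last]
    simp only [simplexPts_mulVec_castSucc, Finset.sum_sub_distrib, ← Finset.mul_sum, ih]
    have : (d : ℝ) + 2 ≠ 0 := by positivity
    simp
    field_simp
    ring

theorem sum_sq_simplexPts_mulVec (d : ℕ) (y : Fin (d + 1) → ℝ) :
    ∑ i, (simplexPts (d + 1) *ᵥ y) i ^ 2 =
      ((d : ℝ) + 2) / ((d : ℝ) + 1) * ∑ k, y k ^ 2 := by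
  induction d with
  | zero =>
    simp [mulVec, dotProduct, simplexPts]
  | succ d ih =>
    have h₂ : (d : ℝ) + 2 ≠ 0 := by positivity
    have h₁ : (d : ℝ) + 1 ≠ 0 := by positivity
    rw [Fin.sum_univ_castSucc, simplexPts_mulVec_last, Fin.sum_univ_castSucc (fun k => y k ^ 2)]
    simp only [simplexPts_mulVec_castSucc, sub_sq, Finset.sum_add_distrib,
      Finset.sum_sub_distrib, mul_pow, ← Finset.mul_sum, ← Finset.sum_mul, ih,
      sum_simplexPts_mulVec]
    have hR : Real.sqrt (((d : ℝ) + 2) ^ 2 - 1) ^ 2 = ((d : ℝ) + 2) ^ 2 - 1 :=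
      Real.sq_sqrt (by nlinarith [(Nat.cast_nonneg d : (0 : ℝ) ≤ d)])
    rw [div_pow, hR]
    simp only [Finset.sum_const, Finset.card_univ, Fintype.card_fin, nsmul_eq_mul]
    push_cast
    have h₃ : (d : ℝ) + 1 + 1 ≠ 0 := by positivity
    field_simp
    ring

/-- for every `y ∈ ℝ^d`, the barycentric coordinate vector
`λ = (1/(d+1)) 𝟙_{d+1} + (d/(d+1)) X_d y` satisfies
`∑ⱼ λⱼ² = (1 + d‖y‖₂²)/(d+1)`; in particular if `‖y‖₂ ≤ 1` then `∑ⱼ λⱼ² ≤ 1`. -/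
theorem sum_sq_bary (d : ℕ) (hd : 1 ≤ d) (y : Fin d → ℝ) :
    ∑ j : Fin (d + 1), bary d y j ^ 2 =
      (1 + (d : ℝ) * ∑ k : Fin d, y k ^ 2) / ((d : ℝ) + 1) ∧
    (Real.sqrt (∑ k : Fin d, y k ^ 2) ≤ 1 → ∑ j : Fin (d + 1), bary d y j ^ 2 ≤ 1) := by
  have key : ∑ j : Fin (d + 1), bary d y j ^ 2 =
      (1 + (d : ℝ) * ∑ k : Fin d, y k ^ 2) / ((d : ℝ) + 1) := by
    obtain ⟨n, rfl⟩ : ∃ n, d = n + 1 := ⟨d - 1, by omega⟩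
    simp only [bary, add_sq, mul_pow, Finset.sum_add_distrib, ← Finset.mul_sum,
      sum_simplexPts_mulVec, sum_sq_simplexPts_mulVec]
    simp only [Finset.sum_const, Finset.card_univ, Fintype.card_fin, nsmul_eq_mul]
    push_cast
    have h₁ : (n : ℝ) + 1 ≠ 0 := by positivity
    have h₂ : (n : ℝ) + 1 + 1 ≠ 0 := by positivity
    field_simp
    ring
  refine ⟨key, fun h => ?_⟩
  rw [Real.sqrt_le_iff, one_pow] at h
  rw [key, div_le_one (by positivity)]
  nlinarith [(Nat.cast_nonneg d : (0 : ℝ) ≤ d), h.2]
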